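/- For every integer s ≥ 2, the function π_s is a probability density on (0, K]: π_s(x) ≥ 0 for all x ∈ (0, K], π_s(x) = 0 for x > K, and ∫_0^K π_s(x) dx = 1. -/

import Mathlib

open MeasureTheory Real

noncomputable def eulerBeta (a b : ℝ) : ℝ := Real.Gamma a * Real.Gamma b / Real.Gamma (a + b)

noncomputable def Kc (s : ℕ) : ℝ := ((s : ℝ) + 1) ^ (s + 1) / (s : ℝ) ^ s

noncomputable def tauProd {s : ℕ} (t : Fin s → ℝ) : ℝ := ∏ i, t i

def cube (s : ℕ) : Set (Fin s → ℝ) := Set.univ.pi fun _ => Set.Icc (0 : ℝ) 1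

noncomputable def Cnorm (s : ℕ) : ℝ :=
  1 / (eulerBeta (1 / ((s : ℝ) + 1)) (((s : ℝ) - 1) / (2 * (s : ℝ) + 2)) *
      ∏ j ∈ Finset.Icc 2 s,
        eulerBeta ((j : ℝ) / ((s : ℝ) + 1)) ((j : ℝ) / ((s : ℝ) * ((s : ℝ) + 1))))

noncomputable def Fdens (s : ℕ) (t : Fin s → ℝ) : ℝ :=
  Cnorm s * ∏ i : Fin s,
    if (i : ℕ) = 0 then
      t i ^ (1 / ((s : ℝ) + 1) - 1) * (1 - t i) ^ (((s : ℝ) - 1) / (2 * (s : ℝ) + 2) - 1)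
    else
      t i ^ ((((i : ℕ) : ℝ) + 1) / ((s : ℝ) + 1) - 1) *
        (1 - t i) ^ ((((i : ℕ) : ℝ) + 1) / ((s : ℝ) * ((s : ℝ) + 1)) - 1)

noncomputable def piDens (s : ℕ) (x : ℝ) : ℝ :=
  (1 / eulerBeta (1 / 2) (1 / 2 + 1 / (s : ℝ))) *
    ∫ t in cube s,
      if x ≤ tauProd t * Kc s then
        (tauProd t * Kc s - x) ^ (1 / (s : ℝ) - 1 / 2) * x ^ (-(1 : ℝ) / 2) *
          (tauProd t * Kc s) ^ (-(1 : ℝ) / (s : ℝ)) * Fdens s t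
      else 0


lemma eulerBeta_pos' {a b : ℝ} (ha : 0 < a) (hb : 0 < b) : 0 < eulerBeta a b :=
  ProbabilityTheory.beta_pos ha hb

lemma beta_scaled_integral {u v a : ℝ} (hu : 0 < u) (hv : 0 < v) (ha : 0 < a) :
    ∫ x in Set.Ioc (0 : ℝ) a, x ^ (u - 1) * (a - x) ^ (v - 1) =
      a ^ (u + v - 1) * eulerBeta u v := by
  have h := Complex.betaIntegral_scaled (u : ℂ) (v : ℂ) ha
  have e : Complex.betaIntegral (u : ℂ) (v : ℂ) = ((eulerBeta u v : ℝ) : ℂ) := by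
    rw [Complex.betaIntegral_eq_Gamma_mul_div _ _ (by simpa) (by simpa), ← Complex.ofReal_add,
      Complex.Gamma_ofReal, Complex.Gamma_ofReal, Complex.Gamma_ofReal, eulerBeta]
    push_cast
    rfl
  rw [e, intervalIntegral.integral_of_le ha.le] at h
  have h2 : ∫ x in Set.Ioc (0 : ℝ) a, (x : ℂ) ^ ((u : ℂ) - 1) * ((a : ℂ) - x) ^ ((v : ℂ) - 1) =
      ∫ x in Set.Ioc (0 : ℝ) a, ((x ^ (u - 1) * (a - x) ^ (v - 1) : ℝ) : ℂ) := by
    refine setIntegral_congr_fun measurableSet_Ioc fun x hx => ?_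
    rw [Complex.ofReal_mul, Complex.ofReal_cpow hx.1.le,
      Complex.ofReal_cpow (sub_nonneg.2 hx.2)]
    push_cast
    rfl
  rw [h2, integral_complex_ofReal] at h
  have h3 : (a : ℂ) ^ ((u : ℂ) + v - 1) = ((a ^ (u + v - 1) : ℝ) : ℂ) := by
    rw [Complex.ofReal_cpow ha.le]
    push_cast
    rfl
  rw [h3] at h
  exact_mod_cast h

lemma beta_scaled_integrable {u v a : ℝ} (hu : 0 < u) (hv : 0 < v) (ha : 0 < a) :
    IntegrableOn (fun x : ℝ => x ^ (u - 1) * (a - x) ^ (v - 1)) (Set.Ioc (0 : ℝ) a) := by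
  by_contra hc
  have h := integral_undef hc
  rw [beta_scaled_integral hu hv ha] at h
  have := mul_pos (Real.rpow_pos_of_pos ha (u + v - 1)) (eulerBeta_pos' hu hv)
  linarith

/-- first exponent -/
noncomputable def expU (s : ℕ) (i : Fin s) : ℝ := (((i : ℕ) : ℝ) + 1) / ((s : ℝ) + 1)

/-- second exponent -/
noncomputable def expV (s : ℕ) (i : Fin s) : ℝ :=
  if (i : ℕ) = 0 then ((s : ℝ) - 1) / (2 * (s : ℝ) + 2)
  else (((i : ℕ) : ℝ) + 1) / ((s : ℝ) * ((s : ℝ) + 1))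

lemma expU_pos (s : ℕ) (i : Fin s) : 0 < expU s i := by
  unfold expU; positivity

lemma expV_pos (s : ℕ) (hs : 2 ≤ s) (i : Fin s) : 0 < expV s i := by
  have h2 : (2 : ℝ) ≤ s := by exact_mod_cast hs
  unfold expV
  split_ifs
  · apply div_pos <;> linarith
  · positivity

lemma Fdens_eq (s : ℕ) (t : Fin s → ℝ) :
    Fdens s t = Cnorm s * ∏ i, (t i ^ (expU s i - 1) * (1 - t i) ^ (expV s i - 1)) := by
  unfold Fdens
  congr 1
  refine Finset.prod_congr rfl fun i _ => ?_
  unfold expU expV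
  split_ifs with h
  · simp [h]
  · rfl

lemma Cnorm_eq (s : ℕ) (hs : 2 ≤ s) :
    Cnorm s = 1 / ∏ i, eulerBeta (expU s i) (expV s i) := by
  unfold Cnorm
  congr 1
  obtain ⟨n, rfl⟩ : ∃ n, s = n + 1 := ⟨s - 1, by omega⟩
  rw [Fin.prod_univ_succ]
  congr 1
  · simp [expU, expV]
  · rw [show Finset.Icc 2 (n + 1) = Finset.Ico 2 (n + 2) by ext; simp; omega,
      Finset.prod_Ico_eq_prod_range, ← Fin.prod_univ_eq_prod_range
        (fun j => eulerBeta (((2 + j : ℕ) : ℝ) / (((n + 1 : ℕ) : ℝ) + 1))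
          (((2 + j : ℕ) : ℝ) / (((n + 1 : ℕ) : ℝ) * (((n + 1 : ℕ) : ℝ) + 1))))]
    refine Finset.prod_congr rfl fun i _ => ?_
    have : (((2 + (i : ℕ) : ℕ) : ℝ)) = ((i : ℕ) : ℝ) + 1 + 1 := by push_cast; ring
    simp only [expU, expV, Fin.val_succ, Nat.succ_ne_zero, if_false, this, Nat.cast_add,
      Nat.cast_one]

lemma Cnorm_pos (s : ℕ) (hs : 2 ≤ s) : 0 < Cnorm s := by
  rw [Cnorm_eq s hs]
  exact one_div_pos.2 (Finset.prod_pos fun i _ => eulerBeta_pos' (expU_pos s i) (expV_pos s hs i))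

lemma restrict_cube (s : ℕ) : (volume : Measure (Fin s → ℝ)).restrict (cube s) =
    Measure.pi fun _ => (volume : Measure ℝ).restrict (Set.Ioc (0 : ℝ) 1) := by
  rw [cube, volume_pi, Measure.restrict_pi_pi]
  congr 1
  funext i
  exact (restrict_Ioc_eq_restrict_Icc).symm

lemma Fdens_integrable (s : ℕ) (hs : 2 ≤ s) : Integrable (Fdens s) (volume.restrict (cube s)) := by
  rw [show Fdens s = _ from funext (Fdens_eq s), restrict_cube]
  refine Integrable.const_mul ?_ _
  exact Integrable.fintype_prod
    (f := fun i (x : ℝ) => x ^ (expU s i - 1) * (1 - x) ^ (expV s i - 1))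
    fun i => beta_scaled_integrable (expU_pos s i) (expV_pos s hs i) one_pos

lemma Fdens_integral (s : ℕ) (hs : 2 ≤ s) : ∫ t in cube s, Fdens s t = 1 := by
  simp_rw [Fdens_eq]
  rw [restrict_cube, integral_const_mul, integral_fintype_prod_eq_prod
    (fun i (x : ℝ) => x ^ (expU s i - 1) * (1 - x) ^ (expV s i - 1)), Cnorm_eq s hs]
  simp_rw [fun i => beta_scaled_integral (expU_pos s i) (expV_pos s hs i) one_pos, Real.one_rpow,
    one_mul]
  exact one_div_mul_cancel
    (Finset.prod_pos fun i _ => eulerBeta_pos' (expU_pos s i) (expV_pos s hs i)).ne'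

lemma Fdens_nonneg (s : ℕ) (hs : 2 ≤ s) {t : Fin s → ℝ} (ht : t ∈ cube s) : 0 ≤ Fdens s t := by
  rw [Fdens_eq]
  refine mul_nonneg (Cnorm_pos s hs).le (Finset.prod_nonneg fun i _ => ?_)
  have h := ht i (Set.mem_univ i)
  exact mul_nonneg (Real.rpow_nonneg h.1 _) (Real.rpow_nonneg (sub_nonneg.2 h.2) _)

/-- the integrand -/
noncomputable def Gint (s : ℕ) (x : ℝ) (t : Fin s → ℝ) : ℝ :=
  if x ≤ tauProd t * Kc s then
    (tauProd t * Kc s - x) ^ (1 / (s : ℝ) - 1 / 2) * x ^ (-(1 : ℝ) / 2) *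
      (tauProd t * Kc s) ^ (-(1 : ℝ) / (s : ℝ)) * Fdens s t
  else 0

lemma measurable_tauProd (s : ℕ) : Measurable (tauProd : (Fin s → ℝ) → ℝ) := by
  unfold tauProd; fun_prop

lemma measurable_Fdens (s : ℕ) : Measurable (Fdens s) := by
  rw [show Fdens s = _ from funext (Fdens_eq s)]
  fun_prop

lemma measurable_Gint (s : ℕ) : Measurable (Function.uncurry (Gint s)) := by
  have h1 := measurable_tauProd s
  have h2 := measurable_Fdens s
  unfold Gint Function.uncurry
  refine Measurable.ite ?_ ?_ measurable_const
  · exact measurableSet_le measurable_fst (by fun_prop)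
  · fun_prop

lemma Kc_pos (s : ℕ) (hs : 2 ≤ s) : 0 < Kc s := by
  unfold Kc
  have : (0 : ℝ) < s := by exact_mod_cast (by omega : 0 < s)
  positivity

lemma tau_nonneg {s : ℕ} {t : Fin s → ℝ} (ht : t ∈ cube s) : 0 ≤ tauProd t :=
  Finset.prod_nonneg fun i _ => (ht i (Set.mem_univ i)).1

lemma tau_le_one {s : ℕ} {t : Fin s → ℝ} (ht : t ∈ cube s) : tauProd t ≤ 1 :=
  Finset.prod_le_one (fun i _ => (ht i (Set.mem_univ i)).1) fun i _ => (ht i (Set.mem_univ i)).2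

lemma measurableSet_cube (s : ℕ) : MeasurableSet (cube s) :=
  MeasurableSet.univ_pi fun _ => measurableSet_Icc

lemma Gint_nonneg (s : ℕ) (hs : 2 ≤ s) {x : ℝ} (hx : 0 < x) {t : Fin s → ℝ} (ht : t ∈ cube s) :
    0 ≤ Gint s x t := by
  unfold Gint
  split_ifs with h
  · have h1 := Fdens_nonneg s hs ht
    have h2 := mul_nonneg (tau_nonneg ht) (Kc_pos s hs).le
    exact mul_nonneg (mul_nonneg (mul_nonneg (Real.rpow_nonneg (sub_nonneg.2 h) _)
      (Real.rpow_nonneg hx.le _)) (Real.rpow_nonneg h2 _)) h1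
  · exact le_rfl

lemma Gint_eq (s : ℕ) (t : Fin s → ℝ) : (fun x => Gint s x t) =
    (Set.Iic (tauProd t * Kc s)).indicator (fun x =>
      ((tauProd t * Kc s) ^ (-(1 : ℝ) / (s : ℝ)) * Fdens s t) *
        (x ^ ((1 / 2 : ℝ) - 1) * (tauProd t * Kc s - x) ^ ((1 / 2 + 1 / (s : ℝ)) - 1))) := by
  funext x
  simp only [Gint, Set.indicator, Set.mem_Iic]
  split_ifs with h
  · rw [show (1 / 2 : ℝ) - 1 = -1 / 2 by norm_num,
      show (1 / 2 + 1 / (s : ℝ)) - 1 = 1 / (s : ℝ) - 1 / 2 by ring]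
    ring
  · rfl

lemma Ioc_inter (s : ℕ) (hs : 2 ≤ s) {t : Fin s → ℝ} (ht : t ∈ cube s) :
    Set.Ioc 0 (Kc s) ∩ Set.Iic (tauProd t * Kc s) = Set.Ioc 0 (tauProd t * Kc s) := by
  have h := mul_le_of_le_one_left (Kc_pos s hs).le (tau_le_one ht)
  ext x
  simp only [Set.mem_inter_iff, Set.mem_Ioc, Set.mem_Iic]
  constructor
  · rintro ⟨⟨a, b⟩, c⟩; exact ⟨a, c⟩
  · rintro ⟨a, c⟩; exact ⟨⟨a, c.trans h⟩, c⟩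

lemma Gint_x (s : ℕ) (hs : 2 ≤ s) {t : Fin s → ℝ} (ht : t ∈ cube s) (h0 : 0 < tauProd t) :
    IntegrableOn (fun x => Gint s x t) (Set.Ioc 0 (Kc s)) ∧
    ∫ x in Set.Ioc 0 (Kc s), Gint s x t =
      eulerBeta (1 / 2) (1 / 2 + 1 / (s : ℝ)) * Fdens s t := by
  have hA := mul_pos h0 (Kc_pos s hs)
  have hv : (0 : ℝ) < 1 / 2 + 1 / (s : ℝ) := by positivity
  have hu : (0 : ℝ) < 1 / 2 := by norm_num
  rw [Gint_eq]
  constructor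
  · rw [IntegrableOn, integrable_indicator_iff measurableSet_Iic, IntegrableOn,
      Measure.restrict_restrict measurableSet_Iic, Set.inter_comm, Ioc_inter s hs ht]
    exact (beta_scaled_integrable hu hv hA).const_mul _
  · rw [setIntegral_indicator measurableSet_Iic, Ioc_inter s hs ht, integral_const_mul,
      beta_scaled_integral hu hv hA]
    have : (tauProd t * Kc s) ^ (-(1 : ℝ) / (s : ℝ)) *
        (tauProd t * Kc s) ^ (1 / 2 + (1 / 2 + 1 / (s : ℝ)) - 1) = 1 := by
      rw [← Real.rpow_add hA]
      rw [show -(1 : ℝ) / (s : ℝ) + (1 / 2 + (1 / 2 + 1 / (s : ℝ)) - 1) = 0 by ring,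
        Real.rpow_zero]
    linear_combination (eulerBeta (1 / 2) (1 / 2 + 1 / (s : ℝ)) * Fdens s t) * this

lemma ae_tau_pos (s : ℕ) : ∀ᵐ t ∂(volume.restrict (cube s)), t ∈ cube s ∧ 0 < tauProd t := by
  have h1 : ∀ᵐ t ∂(volume.restrict (cube s)), t ∈ cube s :=
    ae_restrict_mem (measurableSet_cube s)
  have h2 : ∀ᵐ t ∂(volume.restrict (cube s)), ∀ i, t i ∈ Set.Ioc (0 : ℝ) 1 := by
    rw [restrict_cube, ae_all_iff]
    intro i
    exact (Measure.quasiMeasurePreserving_eval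
      (μ := fun _ : Fin s => (volume : Measure ℝ).restrict (Set.Ioc (0 : ℝ) 1)) i).ae
      (ae_restrict_mem measurableSet_Ioc)
  filter_upwards [h1, h2] with t h1 h2
  exact ⟨h1, Finset.prod_pos fun i _ => (h2 i).1⟩

lemma Gint_integrable (s : ℕ) (hs : 2 ≤ s) : Integrable (Function.uncurry (Gint s))
    ((volume.restrict (Set.Ioc 0 (Kc s))).prod (volume.restrict (cube s))) := by
  rw [integrable_prod_iff' (measurable_Gint s).aestronglyMeasurable]
  constructor
  · filter_upwards [ae_tau_pos s] with t ht
    exact (Gint_x s hs ht.1 ht.2).1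
  · refine ((Fdens_integrable s hs).const_mul (eulerBeta (1 / 2) (1 / 2 + 1 / (s : ℝ)))).congr ?_
    filter_upwards [ae_tau_pos s] with t ht
    rw [← (Gint_x s hs ht.1 ht.2).2]
    refine setIntegral_congr_fun measurableSet_Ioc fun x hx => ?_
    exact (Real.norm_of_nonneg (Gint_nonneg s hs hx.1 ht.1)).symm

lemma piDens_eq (s : ℕ) (x : ℝ) : piDens s x =
    (1 / eulerBeta (1 / 2) (1 / 2 + 1 / (s : ℝ))) * ∫ t in cube s, Gint s x t := rfl

/-- For every integer `s ≥ 2`, the function `π_s` is a probability density on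
`(0, K]`: it is nonnegative on `(0, K]`, vanishes for `x > K`, and integrates to `1`. -/
theorem piDens_isProbabilityDensity (s : ℕ) (hs : 2 ≤ s) :
    (∀ x ∈ Set.Ioc (0 : ℝ) (Kc s), 0 ≤ piDens s x) ∧
    (∀ x : ℝ, Kc s < x → piDens s x = 0) ∧
    ∫ x in (0 : ℝ)..(Kc s), piDens s x = 1 := by
  have hB : 0 < eulerBeta (1 / 2) (1 / 2 + 1 / (s : ℝ)) :=
    eulerBeta_pos' (by norm_num) (by positivity)
  refine ⟨fun x hx => ?_, fun x hx => ?_, ?_⟩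
  · rw [piDens_eq]
    exact mul_nonneg (one_div_pos.2 hB).le
      (setIntegral_nonneg (measurableSet_cube s) fun t ht => Gint_nonneg s hs hx.1 ht)
  · rw [piDens_eq, setIntegral_eq_zero_of_forall_eq_zero, mul_zero]
    intro t ht
    have h := mul_le_of_le_one_left (Kc_pos s hs).le (tau_le_one ht)
    exact if_neg (not_le.2 (h.trans_lt hx))
  · rw [intervalIntegral.integral_of_le (Kc_pos s hs).le]
    simp_rw [piDens_eq]
    rw [integral_const_mul, integral_integral_swap (Gint_integrable s hs)]
    have : ∫ t in cube s, ∫ x in Set.Ioc 0 (Kc s), Gint s x t =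
        ∫ t in cube s, eulerBeta (1 / 2) (1 / 2 + 1 / (s : ℝ)) * Fdens s t := by
      refine integral_congr_ae ?_
      filter_upwards [ae_tau_pos s] with t ht
      exact (Gint_x s hs ht.1 ht.2).2
    rw [this, integral_const_mul, Fdens_integral s hs, mul_one]
    exact one_div_mul_cancel hB.ne'
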